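/- For a linear pentapod design with planar base, the following are equivalent: (i) for every fixed (u,v,w,p_x,p_y) the map p_z ↦ det S(u,v,w,p_x,p_y,p_z) is affine (i.e., the coefficient of p_z² vanishes for all orientations); (ii) det S is linear in the position variables (i.e., for every fixed (u,v,w) the map (p_x,p_y,p_z) ↦ det S is affine). -/

import Mathlib

open Matrix

/-- The 7×7 matrix `S` of a linear pentapod design with platform parameters
`r` and base coordinates `x`, `y`, `z` (indices `1,…,4` of `Fin 5` correspond to
legs `2,…,5`; index `0` corresponds to leg `1`), at pose `(u,v,w,px,py,pz)`. -/
noncomputable def Smat (r x y z : Fin 5 → ℝ) (u v w px py pz : ℝ) :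
    Matrix (Fin 7) (Fin 7) ℝ :=
  !![(1 : ℝ), u, v, w, px, py, pz;
     0, px, py, pz, 0, 0, 0;
     0, 0, 0, 0, u, v, w;
     r 1, x 1, y 1, z 1, r 1 * x 1, r 1 * y 1, r 1 * z 1;
     r 2, x 2, y 2, z 2, r 2 * x 2, r 2 * y 2, r 2 * z 2;
     r 3, x 3, y 3, z 3, r 3 * x 3, r 3 * y 3, r 3 * z 3;
     r 4, x 4, y 4, z 4, r 4 * x 4, r 4 * y 4, r 4 * z 4]

/-- The 4×7 architecture matrix of the design. -/
noncomputable def archMat (r x y z : Fin 5 → ℝ) : Matrix (Fin 4) (Fin 7) ℝ :=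
  !![r 1, x 1, y 1, z 1, r 1 * x 1, r 1 * y 1, r 1 * z 1;
     r 2, x 2, y 2, z 2, r 2 * x 2, r 2 * y 2, r 2 * z 2;
     r 3, x 3, y 3, z 3, r 3 * x 3, r 3 * y 3, r 3 * z 3;
     r 4, x 4, y 4, z 4, r 4 * x 4, r 4 * y 4, r 4 * z 4]

/-- The design is architecturally singular: the singularity polynomial `det S`
vanishes at every pose on the quadric `u² + v² + w² = 1`. -/
def ArchSingular (r x y z : Fin 5 → ℝ) : Prop :=
  ∀ u v w px py pz : ℝ, u ^ 2 + v ^ 2 + w ^ 2 = 1 →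
    (Smat r x y z u v w px py pz).det = 0

/-- The bracket `[A₁, A₂, A₃, A₄]`: the determinant of the 4×4 matrix with
columns `A₁, A₂, A₃, A₄`. -/
noncomputable def bracket (A1 A2 A3 A4 : Fin 4 → ℝ) : ℝ :=
  (Matrix.of fun i j => ![A1, A2, A3, A4] j i).det

/-- The vector in `ℝ⁴` formed by the values of `f` at legs `2,…,5`. -/
def colVec (f : Fin 5 → ℝ) : Fin 4 → ℝ := fun i => f i.succ

/-- The componentwise product vector (e.g. `rX`, `rY`, `rZ`) for legs `2,…,5`. -/
def colProd (r f : Fin 5 → ℝ) : Fin 4 → ℝ := fun i => r i.succ * f i.succ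

/-- The base anchor point `M_j = (x_j, y_j, z_j) ∈ ℝ³`. -/
def Mpt (x y z : Fin 5 → ℝ) (j : Fin 5) : Fin 3 → ℝ := ![x j, y j, z j]

/-- The maximal minor omitting column `k` of the `4 × 5` matrix with columns
`R, X, Y, RX, RY`, i.e. of the architecture matrix with its zero columns removed. -/
noncomputable def planarMinor (r x y : Fin 5 → ℝ) (k : Fin 5) : ℝ :=
  ((!![r 1, x 1, y 1, r 1 * x 1, r 1 * y 1;
       r 2, x 2, y 2, r 2 * x 2, r 2 * y 2;
       r 3, x 3, y 3, r 3 * x 3, r 3 * y 3;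
       r 4, x 4, y 4, r 4 * x 4, r 4 * y 4] :
    Matrix (Fin 4) (Fin 5) ℝ).submatrix id k.succAbove).det

/-- Expansion of a `7 × 7` determinant whose fourth column vanishes below its second entry. -/
theorem det_expand_fourth_column (A : Matrix (Fin 7) (Fin 7) ℝ)
    (h : ∀ i : Fin 5, A i.succ.succ 3 = 0) :
    A.det = -A 0 3 * (A.submatrix (Fin.succAbove 0) (Fin.succAbove 3)).det
      + A 1 3 * (A.submatrix (Fin.succAbove 1) (Fin.succAbove 3)).det := by
  rw [det_succ_column _ 3, Fin.sum_univ_succ, Fin.sum_univ_succ,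
    Finset.sum_eq_zero (fun i _ => by rw [h]; ring)]
  have h3 : ((3 : Fin 7) : ℕ) = 3 := rfl
  have h1 : ((Fin.succ 0 : Fin 7) : ℕ) = 1 := rfl
  rw [h1, h3]
  norm_num

/-- Expansion of a `6 × 6` determinant whose last column vanishes below its second entry. -/
theorem det_expand_last_column (A : Matrix (Fin 6) (Fin 6) ℝ)
    (h : ∀ i : Fin 4, A i.succ.succ 5 = 0) :
    A.det = -A 0 5 * (A.submatrix (Fin.succAbove 0) (Fin.succAbove 5)).det
      + A 1 5 * (A.submatrix (Fin.succAbove 1) (Fin.succAbove 5)).det := by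
  rw [det_succ_column _ 5, Fin.sum_univ_succ, Fin.sum_univ_succ,
    Finset.sum_eq_zero (fun i _ => by rw [h]; ring)]
  have h3 : ((5 : Fin 6) : ℕ) = 5 := rfl
  have h1 : ((Fin.succ 0 : Fin 6) : ℕ) = 1 := rfl
  rw [h1, h3]
  norm_num

/-- Expansion along the first row of a `5 × 5` determinant with lower rows
`R, X, Y, RX, RY`. -/
theorem det_row_over_planarArch (r x y : Fin 5 → ℝ) (a b c d e : ℝ) :
    (!![a, b, c, d, e;
        r 1, x 1, y 1, r 1 * x 1, r 1 * y 1;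
        r 2, x 2, y 2, r 2 * x 2, r 2 * y 2;
        r 3, x 3, y 3, r 3 * x 3, r 3 * y 3;
        r 4, x 4, y 4, r 4 * x 4, r 4 * y 4] : Matrix (Fin 5) (Fin 5) ℝ).det =
      a * planarMinor r x y 0 - b * planarMinor r x y 1 + c * planarMinor r x y 2
        - d * planarMinor r x y 3 + e * planarMinor r x y 4 := by
  have h (k : Fin 5) : planarMinor r x y k =
      ((!![a, b, c, d, e;
        r 1, x 1, y 1, r 1 * x 1, r 1 * y 1;
        r 2, x 2, y 2, r 2 * x 2, r 2 * y 2;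
        r 3, x 3, y 3, r 3 * x 3, r 3 * y 3;
        r 4, x 4, y 4, r 4 * x 4, r 4 * y 4] : Matrix (Fin 5) (Fin 5) ℝ).submatrix
          Fin.succ k.succAbove).det := rfl
  rw [det_succ_row_zero, Fin.sum_univ_five]
  simp only [← h]
  simp
  ring

/-- Laplace expansion of `det S` for a planar base. -/
theorem det_Smat_of_planar (r x y z : Fin 5 → ℝ) (hplanar : ∀ j, z j = 0)
    (u v w px py pz : ℝ) :
    (Smat r x y z u v w px py pz).det =
      pz * w * planarMinor r x y 0 - (u * pz * w - px * w ^ 2) * planarMinor r x y 1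
        + (v * pz * w - py * w ^ 2) * planarMinor r x y 2
        - (px * pz * w - u * pz ^ 2) * planarMinor r x y 3
        + (py * pz * w - v * pz ^ 2) * planarMinor r x y 4 := by
  obtain rfl : z = fun _ => 0 := funext hplanar
  rw [det_expand_fourth_column _ (by intro i; fin_cases i <;> rfl),
    det_expand_last_column _ (by intro i; fin_cases i <;> simp [Smat, Fin.succAbove]),
    det_expand_last_column _ (by intro i; fin_cases i <;> simp [Smat, Fin.succAbove])]
  set S := Smat r x y (fun _ => 0) u v w px py pz
  have base : ((S.submatrix (Fin.succAbove 0) (Fin.succAbove 3)).submatrix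
      (Fin.succAbove 1) (Fin.succAbove 5)).det = _ :=
    Eq.trans (congrArg det (by ext i j; fin_cases i <;> fin_cases j <;> rfl))
      (det_row_over_planarArch r x y 0 px py 0 0)
  have orient : ((S.submatrix (Fin.succAbove 1) (Fin.succAbove 3)).submatrix
      (Fin.succAbove 0) (Fin.succAbove 5)).det = _ :=
    Eq.trans (congrArg det (by ext i j; fin_cases i <;> fin_cases j <;> rfl))
      (det_row_over_planarArch r x y 0 0 0 u v)
  have pose : ((S.submatrix (Fin.succAbove 1) (Fin.succAbove 3)).submatrix
      (Fin.succAbove 1) (Fin.succAbove 5)).det = _ :=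
    Eq.trans (congrArg det (by ext i j; fin_cases i <;> fin_cases j <;> rfl))
      (det_row_over_planarArch r x y 1 u v px py)
  rw [base, orient, pose,
    show S 0 3 = w from rfl, show S 1 3 = pz from rfl,
    show S.submatrix (Fin.succAbove 0) (Fin.succAbove 3) 0 5 = 0 from rfl,
    show S.submatrix (Fin.succAbove 0) (Fin.succAbove 3) 1 5 = w from rfl,
    show S.submatrix (Fin.succAbove 1) (Fin.succAbove 3) 0 5 = pz from rfl,
    show S.submatrix (Fin.succAbove 1) (Fin.succAbove 3) 1 5 = w from rfl]
  ring

theorem stmt9 (r x y z : Fin 5 → ℝ)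
    (hr1 : r 0 = 0) (hx1 : x 0 = 0) (hy1 : y 0 = 0) (hz1 : z 0 = 0)
    (hplanar : ∀ j, z j = 0) :
    (∀ u v w px py : ℝ, ∃ a b : ℝ, ∀ pz : ℝ,
        (Smat r x y z u v w px py pz).det = a * pz + b) ↔
      (∀ u v w : ℝ, ∃ a b c d : ℝ, ∀ px py pz : ℝ,
        (Smat r x y z u v w px py pz).det = a * px + b * py + c * pz + d) := by
  simp only [det_Smat_of_planar r x y z hplanar]
  constructor
  · intro h
    have h3 : planarMinor r x y 3 = 0 := by
      obtain ⟨a, b, hab⟩ := h 1 0 0 0 0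
      linarith [hab 0, hab 1, hab (-1)]
    have h4 : planarMinor r x y 4 = 0 := by
      obtain ⟨a, b, hab⟩ := h 0 1 0 0 0
      linarith [hab 0, hab 1, hab (-1)]
    intro u v w
    refine ⟨w ^ 2 * planarMinor r x y 1, -w ^ 2 * planarMinor r x y 2,
      w * planarMinor r x y 0 - u * w * planarMinor r x y 1 + v * w * planarMinor r x y 2, 0,
      fun px py pz => ?_⟩
    rw [h3, h4]
    ring
  · intro h u v w px py
    obtain ⟨a, b, c, d, hd⟩ := h u v w
    exact ⟨c, a * px + b * py + d, fun pz => by rw [hd]; ring⟩
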